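/- The anti-involutions of 𝒟ᵃ preserving the principal ℤ-gradation are exactly the maps σ_{±,c} (c ∈ ℂ, with a choice of sign) defined by σ_{±,c}(t^k f(D)) = (±1)^k·t^k f(−D − k + c) for k ∈ ℤ, f ∈ ℂ[x]; that is, each σ_{±,c} is an anti-involution preserving the gradation, and every anti-involution of 𝒟ᵃ preserving the gradation is of this form. -/

import Mathlib

noncomputable section

/-- ℂ[t,t⁻¹] as a ℂ-vector space with basis {t^j}_{j∈ℤ}; t^j is `Finsupp.single j 1`. -/
abbrev LaurentV : Type := ℤ →₀ ℂ

/-- The regular differential operator `t^k f(D)` (where D = t·d/dt), acting by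
t^j ↦ f(j)·t^{j+k}. -/
def op (k : ℤ) (f : Polynomial ℂ) : Module.End ℂ LaurentV :=
  Finsupp.lsum ℂ fun j => f.eval (j : ℂ) • Finsupp.lsingle (j + k)

/-- The graded piece (𝒟ᵃ_p)_j = {t^j f(D) p(D) : f ∈ ℂ[x]}. -/
def Dgrade (p : Polynomial ℂ) (j : ℤ) : Submodule ℂ (Module.End ℂ LaurentV) :=
  Submodule.span ℂ {A | ∃ f : Polynomial ℂ, A = op j (f * p)}

/-- 𝒟ᵃ_p = 𝒟ᵃ·p(D). -/
def Dp (p : Polynomial ℂ) : Submodule ℂ (Module.End ℂ LaurentV) :=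
  Submodule.span ℂ {A | ∃ (k : ℤ) (f : Polynomial ℂ), A = op k (f * p)}

/-- σ is an anti-involution: it is ℂ-linear (built into the type), involutive, and
reverses products. -/
def IsAntiInvolutionOn (p : Polynomial ℂ) (σ : ↥(Dp p) →ₗ[ℂ] ↥(Dp p)) : Prop :=
  (∀ A : ↥(Dp p), σ (σ A) = A) ∧
  (∀ A B W : ↥(Dp p),
    (W : Module.End ℂ LaurentV) = (A : Module.End ℂ LaurentV) * (B : Module.End ℂ LaurentV) →
    ((σ W : Module.End ℂ LaurentV)) = (σ B : Module.End ℂ LaurentV) * (σ A : Module.End ℂ LaurentV))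

/-- σ preserves the principal ℤ-gradation. -/
def PreservesGrading (p : Polynomial ℂ) (σ : ↥(Dp p) →ₗ[ℂ] ↥(Dp p)) : Prop :=
  ∀ (j : ℤ) (A : ↥(Dp p)), (A : Module.End ℂ LaurentV) ∈ Dgrade p j →
    ((σ A : Module.End ℂ LaurentV)) ∈ Dgrade p j

/-- σ(t^k f(D) p(D)) = (-1)^{deg p}·e^k·t^k f(−D−k+c)p(D). -/
def SigmaFormula (p : Polynomial ℂ) (c e : ℂ) (σ : ↥(Dp p) →ₗ[ℂ] ↥(Dp p)) : Prop :=
  ∀ (k : ℤ) (f : Polynomial ℂ) (A : ↥(Dp p)), (A : Module.End ℂ LaurentV) = op k (f * p) →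
    ((σ A : Module.End ℂ LaurentV)) =
      ((-1 : ℂ) ^ p.natDegree * e ^ k) •
        op k ((f.comp (Polynomial.C (c - (k : ℂ)) - Polynomial.X)) * p)

/-- The graded piece (𝒟_p^±)_k = {d ∈ (𝒟_p)_k : σ_±(d) = −d}, as a set. -/
def DpmGradeSet (p : Polynomial ℂ) (c e : ℂ) (k : ℤ) : Set (Module.End ℂ LaurentV) :=
  {A | ∃ f : Polynomial ℂ, A = op k (f * p) ∧
    ((-1 : ℂ) ^ p.natDegree * e ^ k) •
      op k ((f.comp (Polynomial.C (c - (k : ℂ)) - Polynomial.X)) * p) = -A}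

/-- The graded piece (𝒟_p^±)_k, as a ℂ-subspace. -/
def DpmGrade (p : Polynomial ℂ) (c e : ℂ) (k : ℤ) : Submodule ℂ (Module.End ℂ LaurentV) :=
  Submodule.span ℂ (DpmGradeSet p c e k)

/-- V has finite codimension in W. -/
def FinCodimIn {M : Type*} [AddCommGroup M] [Module ℂ M] (V W : Submodule ℂ M) : Prop :=
  FiniteDimensional ℂ (↥W ⧸ Submodule.comap W.subtype V)

open Polynomial in
theorem op_single (k j : ℤ) (f : ℂ[X]) (a : ℂ) :
    op k f (Finsupp.single j a) = Finsupp.single (j + k) (f.eval (j : ℂ) * a) := by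
  simp [op]

open Polynomial in
theorem op_mul (k l : ℤ) (f g : ℂ[X]) :
    op k f * op l g = op (k + l) (f.comp (X + C (l : ℂ)) * g) := by
  refine Finsupp.lhom_ext fun j a => ?_
  rw [Module.End.mul_apply, op_single, op_single, op_single]
  have h : j + l + k = j + (k + l) := by ring
  simp [h, mul_assoc]

open Polynomial in
theorem eq_zero_of_eval_intCast {f : ℂ[X]} (h : ∀ j : ℤ, f.eval (j : ℂ) = 0) : f = 0 := by
  refine f.eq_zero_of_infinite_isRoot ?_
  refine (Set.infinite_range_of_injective (Int.cast_injective (α := ℂ))).mono ?_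
  rintro _ ⟨j, rfl⟩
  exact h j

open Polynomial in
theorem exists_eq_C_of_comp_X_add_one {f : ℂ[X]} (h : f.comp (X + C 1) = f) :
    ∃ c, f = C c := by
  have hstep (x : ℂ) : f.eval (x + 1) = f.eval x := by
    conv_rhs => rw [← h]
    simp
  have hnat (n : ℕ) : f.eval (n : ℂ) = f.eval 0 := by
    induction n with
    | zero => simp
    | succ n ih => rw [Nat.cast_succ, hstep, ih]
  refine ⟨f.eval 0, f.eq_of_infinite_eval_eq _ ?_⟩
  refine (Set.infinite_range_of_injective (Nat.cast_injective (R := ℂ))).mono ?_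
  rintro _ ⟨n, rfl⟩
  simp [hnat]

open Polynomial in
/-- `op k` as a linear map in the polynomial. -/
def opLinear (k : ℤ) : ℂ[X] →ₗ[ℂ] Module.End ℂ LaurentV where
  toFun := op k
  map_add' f g := by
    refine Finsupp.lhom_ext fun j a => ?_
    simp [op_single, add_mul]
  map_smul' r f := by
    refine Finsupp.lhom_ext fun j a => ?_
    simp only [op_single, RingHom.id_apply, LinearMap.smul_apply, Finsupp.smul_single, eval_smul,
      smul_eq_mul, mul_assoc]

open Polynomial in
/-- The parametrization of regular differential operators by finitely supported families of
polynomials: `a` is sent to `∑ k, t^k (a k)(D)`. -/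
def opSum : (ℤ →₀ ℂ[X]) →ₗ[ℂ] Module.End ℂ LaurentV :=
  Finsupp.lsum ℂ opLinear

open Polynomial in
theorem opSum_single (k : ℤ) (f : ℂ[X]) : opSum (Finsupp.single k f) = op k f :=
  Finsupp.lsum_single ℂ opLinear k f

open Polynomial in
theorem opSum_apply_single (a : ℤ →₀ ℂ[X]) (j k : ℤ) :
    opSum a (Finsupp.single j 1) (j + k) = (a k).eval (j : ℂ) := by
  induction a using Finsupp.induction_linear with
  | zero => simp
  | add a b ha hb => simp [ha, hb]
  | single l f =>
    rw [opSum_single, op_single]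
    by_cases h : l = k
    · simp [h]
    · simp [h]

theorem opSum_injective : Function.Injective opSum := by
  rw [injective_iff_map_eq_zero]
  intro a ha
  ext1 k
  refine eq_zero_of_eval_intCast fun j => ?_
  rw [← opSum_apply_single, ha]
  simp

theorem op_injective (k : ℤ) : Function.Injective (op k) := by
  intro f g h
  rw [← opSum_single, ← opSum_single] at h
  exact Finsupp.single_injective k (opSum_injective h)

theorem op_mem_Dp_one (k : ℤ) (f : Polynomial ℂ) : op k f ∈ Dp 1 :=
  Submodule.subset_span ⟨k, f, by rw [mul_one]⟩

theorem range_opSum : LinearMap.range opSum = Dp 1 := by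
  apply le_antisymm
  · rintro _ ⟨a, rfl⟩
    induction a using Finsupp.induction_linear with
    | zero => simp
    | add a b ha hb => rw [map_add]; exact add_mem ha hb
    | single k f => rw [opSum_single]; exact op_mem_Dp_one k f
  · refine Submodule.span_le.2 ?_
    rintro _ ⟨k, f, rfl⟩
    exact ⟨Finsupp.single k f, by rw [opSum_single, mul_one]⟩

theorem mem_Dgrade_one {k : ℤ} {A : Module.End ℂ LaurentV} :
    A ∈ Dgrade 1 k ↔ ∃ f, A = op k f := by
  have h : Dgrade 1 k = LinearMap.range (opLinear k) := by
    rw [← Submodule.span_eq (LinearMap.range (opLinear k)), Dgrade]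
    congr 1
    ext B
    simp [opLinear, eq_comm]
  rw [h]
  simp [opLinear, eq_comm]

open Polynomial in
/-- The map `t^k f(D) ↦ e^k t^k f(-D - k + c)` on families of polynomials. -/
def reflectFamily (c e : ℂ) : (ℤ →₀ ℂ[X]) →ₗ[ℂ] (ℤ →₀ ℂ[X]) :=
  Finsupp.lsum ℂ fun k =>
    Finsupp.lsingle k ∘ₗ (e ^ k • (aeval (C (c - (k : ℂ)) - X : ℂ[X])).toLinearMap)

open Polynomial in
theorem reflectFamily_single (c e : ℂ) (k : ℤ) (f : ℂ[X]) :
    reflectFamily c e (Finsupp.single k f) =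
      Finsupp.single k (e ^ k • f.comp (C (c - (k : ℂ)) - X)) := by
  simp [reflectFamily, aeval_def, comp, Polynomial.algebraMap_eq]

open Polynomial in
theorem reflectFamily_involutive (c : ℂ) {e : ℂ} (he : e = 1 ∨ e = -1)
    (a : ℤ →₀ ℂ[X]) : reflectFamily c e (reflectFamily c e a) = a := by
  have he2 (k : ℤ) : e ^ k * e ^ k = 1 := by
    rw [← mul_zpow]
    rcases he with rfl | rfl <;> simp
  induction a using Finsupp.induction_linear with
  | zero => simp
  | add a b ha hb => simp [ha, hb]
  | single k f =>
    rw [reflectFamily_single, reflectFamily_single, smul_comp, smul_smul, he2, one_smul, comp_assoc]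
    simp

open Polynomial in
theorem exists_opSum_eq_mul (c : ℂ) {e : ℂ} (he : e ≠ 0) (a b : ℤ →₀ ℂ[X]) :
    ∃ w, opSum w = opSum a * opSum b ∧
      opSum (reflectFamily c e w) =
        opSum (reflectFamily c e b) * opSum (reflectFamily c e a) := by
  induction a using Finsupp.induction_linear with
  | zero => exact ⟨0, by simp, by simp⟩
  | add a₁ a₂ h₁ h₂ =>
    obtain ⟨w₁, h₁, h₁'⟩ := h₁
    obtain ⟨w₂, h₂, h₂'⟩ := h₂
    exact ⟨w₁ + w₂, by simp [h₁, h₂, add_mul], by simp [h₁', h₂', mul_add]⟩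
  | single k f =>
    induction b using Finsupp.induction_linear with
    | zero => exact ⟨0, by simp, by simp⟩
    | add b₁ b₂ h₁ h₂ =>
      obtain ⟨w₁, h₁, h₁'⟩ := h₁
      obtain ⟨w₂, h₂, h₂'⟩ := h₂
      exact ⟨w₁ + w₂, by simp [h₁, h₂, mul_add], by simp [h₁', h₂', add_mul]⟩
    | single l g =>
      refine ⟨Finsupp.single (k + l) (f.comp (X + C (l : ℂ)) * g), ?_, ?_⟩
      · simp only [opSum_single, op_mul]
      · simp only [reflectFamily_single, opSum_single, op_mul]
        rw [add_comm l k]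
        congr 1
        refine Polynomial.funext fun x => ?_
        simp only [eval_smul, eval_comp, eval_mul, eval_add, eval_sub, eval_X, eval_C, smul_eq_mul,
          zpow_add₀ he]
        push_cast
        ring_nf

theorem exists_antiInvolution (c e : ℂ) (he : e = 1 ∨ e = -1) :
    ∃ σ : ↥(Dp 1) →ₗ[ℂ] ↥(Dp 1),
      IsAntiInvolutionOn 1 σ ∧ PreservesGrading 1 σ ∧ SigmaFormula 1 c e σ := by
  have he0 : e ≠ 0 := by rcases he with rfl | rfl <;> simp
  let Φ : (ℤ →₀ Polynomial ℂ) ≃ₗ[ℂ] ↥(Dp 1) :=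
    (LinearEquiv.ofInjective opSum opSum_injective).trans (LinearEquiv.ofEq _ _ range_opSum)
  have hΦ (a) : (Φ a : Module.End ℂ LaurentV) = opSum a := rfl
  let σ : ↥(Dp 1) →ₗ[ℂ] ↥(Dp 1) := Φ.toLinearMap ∘ₗ reflectFamily c e ∘ₗ Φ.symm.toLinearMap
  have hσ (a) : σ (Φ a) = Φ (reflectFamily c e a) := by simp [σ]
  have hop (k : ℤ) (f : Polynomial ℂ) (A : ↥(Dp 1))
      (hA : (A : Module.End ℂ LaurentV) = op k f) : (σ A : Module.End ℂ LaurentV) =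
        op k (e ^ k • f.comp (Polynomial.C (c - (k : ℂ)) - Polynomial.X)) := by
    have : A = Φ (Finsupp.single k f) := Subtype.ext (by rw [hA, hΦ, opSum_single])
    rw [this, hσ, hΦ, reflectFamily_single, opSum_single]
  refine ⟨σ, ⟨fun A => ?_, fun A B W h => ?_⟩, fun j A hA => ?_, fun k f A hA => ?_⟩
  · obtain ⟨a, rfl⟩ := Φ.surjective A
    rw [hσ, hσ, reflectFamily_involutive c he]
  · obtain ⟨a, rfl⟩ := Φ.surjective A
    obtain ⟨b, rfl⟩ := Φ.surjective B
    obtain ⟨w, rfl⟩ := Φ.surjective W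
    obtain ⟨w', h₁, h₂⟩ := exists_opSum_eq_mul c he0 a b
    simp only [hΦ] at h
    obtain rfl := opSum_injective (h.trans h₁.symm)
    simpa only [hσ, hΦ] using h₂
  · obtain ⟨f, hf⟩ := mem_Dgrade_one.1 hA
    exact mem_Dgrade_one.2 ⟨_, hop j f A hf⟩
  · rw [mul_one] at hA
    rw [hop k f A hA, mul_one, Polynomial.natDegree_one, pow_zero, one_mul]
    exact (opLinear k).map_smul _ _

open Polynomial in
theorem IsAntiInvolutionOn.exists_sigmaFormula {σ : ↥(Dp 1) →ₗ[ℂ] ↥(Dp 1)}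
    (hσ : IsAntiInvolutionOn 1 σ) (hgr : PreservesGrading 1 σ) :
    ∃ c e : ℂ, (e = 1 ∨ e = -1) ∧ SigmaFormula 1 c e σ := by
  obtain ⟨hinv, hanti⟩ := hσ
  have hex (k : ℤ) (f : ℂ[X]) :
      ∃ g, (σ ⟨op k f, op_mem_Dp_one k f⟩ : Module.End ℂ LaurentV) = op k g :=
    mem_Dgrade_one.1 (hgr k _ (mem_Dgrade_one.2 ⟨f, rfl⟩))
  choose S hS using hex
  have S_mul (k l : ℤ) (f g : ℂ[X]) :
      S (k + l) (f.comp (X + C (l : ℂ)) * g) = (S l g).comp (X + C (k : ℂ)) * S k f := by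
    apply op_injective (k + l)
    rw [← hS, hanti ⟨op k f, op_mem_Dp_one k f⟩ ⟨op l g, op_mem_Dp_one l g⟩ _
      (op_mul k l f g).symm, hS, hS, op_mul, add_comm l k]
  have S_S (k : ℤ) (f : ℂ[X]) : S k (S k f) = f := by
    apply op_injective k
    rw [← hS]
    have h : (⟨op k (S k f), op_mem_Dp_one k _⟩ : ↥(Dp 1)) = σ ⟨op k f, op_mem_Dp_one k f⟩ :=
      Subtype.ext (hS k f).symm
    rw [h, hinv]
  have S_add (k : ℤ) (f g : ℂ[X]) : S k (f + g) = S k f + S k g := by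
    apply op_injective k
    rw [← hS]
    have h : (⟨op k (f + g), op_mem_Dp_one k _⟩ : ↥(Dp 1)) =
        ⟨op k f, op_mem_Dp_one k f⟩ + ⟨op k g, op_mem_Dp_one k g⟩ :=
      Subtype.ext ((opLinear k).map_add f g)
    rw [h, map_add, Submodule.coe_add, hS, hS]
    exact ((opLinear k).map_add _ _).symm
  have S_smul (k : ℤ) (r : ℂ) (f : ℂ[X]) : S k (r • f) = r • S k f := by
    apply op_injective k
    rw [← hS]
    have h : (⟨op k (r • f), op_mem_Dp_one k _⟩ : ↥(Dp 1)) = r • ⟨op k f, op_mem_Dp_one k f⟩ :=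
      Subtype.ext ((opLinear k).map_smul r f)
    rw [h, map_smul, Submodule.coe_smul, hS]
    exact ((opLinear k).map_smul _ _).symm
  have S_zero (k : ℤ) : S k 0 = 0 := by simpa using S_smul k 0 0
  have S0_mul (f g : ℂ[X]) : S 0 (f * g) = S 0 f * S 0 g := by
    simpa [mul_comm] using S_mul 0 0 f g
  have S0_one : S 0 1 = 1 := by
    have h := S0_mul 1 (S 0 1)
    rwa [one_mul, S_S, mul_one, eq_comm] at h
  let ψ : ℂ[X] →ₐ[ℂ] ℂ[X] :=
    AlgHom.ofLinearMap { toFun := S 0, map_add' := S_add 0, map_smul' := S_smul 0 } S0_one S0_mul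
  have S0_eq (f : ℂ[X]) : S 0 f = f.comp (S 0 X) := by
    have h : ψ = aeval (S 0 X) := Polynomial.algHom_ext (by simp [ψ])
    exact DFunLike.congr_fun h f
  have S_eq (k : ℤ) (f : ℂ[X]) : S k f = (S 0 f).comp (X + C (k : ℂ)) * S k 1 := by
    simpa using S_mul k 0 1 f
  have S1_ne : S 1 1 ≠ 0 := by
    intro h
    have h' := S_S 1 1
    rw [h, S_zero] at h'
    exact zero_ne_one h'
  obtain ⟨c, hc⟩ : ∃ c, S 0 X = C c - X := by
    have h₁ := S_mul 0 1 X 1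
    have h₂ : (S 0 X).comp (X + C 1) + 1 = S 0 X := by
      refine mul_right_cancel₀ S1_ne ?_
      rw [S_eq] at h₁
      simp only [zero_add, X_comp, mul_one, Int.cast_one, Int.cast_zero, map_zero, add_zero,
        comp_X] at h₁
      rw [S_add, S0_eq (C 1)] at h₁
      rw [mul_comm (S 0 X), ← h₁]
      simp
    obtain ⟨c, hc⟩ := exists_eq_C_of_comp_X_add_one (f := S 0 X + X) (by
      conv_rhs => rw [← h₂]
      simp
      ring)
    exact ⟨c, eq_sub_of_add_eq hc⟩
  obtain ⟨e, he⟩ : ∃ e, S 1 1 = C e := by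
    have h := S_mul 1 (-1) 1 1
    have hu : IsUnit (S 1 1) := by
      refine IsUnit.of_mul_eq_one_right ((S (-1) 1).comp (X + C ((1 : ℤ) : ℂ))) ?_
      rw [← h]
      simpa using S0_one
    obtain ⟨e, -, he⟩ := Polynomial.isUnit_iff.1 hu
    exact ⟨e, he.symm⟩
  have he_sq : e * e = 1 := by
    have h := S_S 1 1
    rw [he, S_eq, he, S0_eq, C_comp, C_comp, ← C_mul, ← C_1] at h
    exact C_injective h
  have he0 : e ≠ 0 := left_ne_zero_of_mul_eq_one he_sq
  have S_succ (k : ℤ) : S (k + 1) 1 = C e * S k 1 := by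
    have h := S_mul k 1 1 1
    rwa [he, one_comp, one_mul, C_comp] at h
  have S_one (k : ℤ) : S k 1 = C (e ^ k) := by
    induction k using Int.induction_on with
    | zero => simpa using S0_one
    | succ n ih => rw [S_succ, ih, ← C_mul, zpow_add_one₀ he0, mul_comm]
    | pred n ih =>
      refine mul_left_cancel₀ (C_ne_zero.2 he0) ?_
      rw [← S_succ, sub_add_cancel, ih, ← C_mul, mul_comm, ← zpow_add_one₀ he0, sub_add_cancel]
  refine ⟨c, e, mul_self_eq_one_iff.1 he_sq, fun k f A hA => ?_⟩
  rw [mul_one] at hA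
  obtain rfl : A = ⟨op k f, op_mem_Dp_one k f⟩ := Subtype.ext hA
  rw [hS, S_eq, S_one, S0_eq, hc, mul_one, natDegree_one, pow_zero, one_mul]
  refine Eq.trans ?_ ((opLinear k).map_smul (e ^ k) _)
  refine congrArg (op k) ?_
  refine Polynomial.funext fun x => ?_
  simp only [eval_smul, eval_comp, eval_mul, eval_add, eval_sub, eval_X, eval_C, smul_eq_mul]
  ring_nf

theorem antiinvolution_classification_Da :
    (∀ (c e : ℂ), e = 1 ∨ e = -1 →
      ∃ σ : ↥(Dp 1) →ₗ[ℂ] ↥(Dp 1),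
        IsAntiInvolutionOn 1 σ ∧ PreservesGrading 1 σ ∧ SigmaFormula 1 c e σ) ∧
    (∀ σ : ↥(Dp 1) →ₗ[ℂ] ↥(Dp 1), IsAntiInvolutionOn 1 σ → PreservesGrading 1 σ →
      ∃ c e : ℂ, (e = 1 ∨ e = -1) ∧ SigmaFormula 1 c e σ) :=
  ⟨exists_antiInvolution, fun _ hσ hgr => hσ.exists_sigmaFormula hgr⟩

end
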